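/- arXiv:2108.06584 — 2 statements merged into one kernel-verified Lean document; each statement's English description precedes it below -/
import Mathlib

section
/- Let a > 0, b > 0 and x > 0 be real numbers. The function F(τ, τ_0, e) = τ·log(1 + (x/τ)·min(a·e, b·τ_0)) is concave on the convex set S = {(τ, τ_0, e) ∈ ℝ³ : τ > 0, τ_0 ≥ 0, e ≥ 0}. -/
theorem eh_rate_concave (a b x : ℝ) (ha : 0 < a) (hb : 0 < b) (hx : 0 < x) :
    ConcaveOn ℝ {q : ℝ × ℝ × ℝ | 0 < q.1 ∧ 0 ≤ q.2.1 ∧ 0 ≤ q.2.2}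
      (fun q : ℝ × ℝ × ℝ =>
        q.1 * Real.log (1 + (x / q.1) * min (a * q.2.2) (b * q.2.1))) := by
  have hpos : ∀ p q t s : ℝ, 0 ≤ p → 0 ≤ q → p + q = 1 → 0 < t → 0 < s →
      0 < p * t + q * s := by
    intro p q t s hp hq h ht hs
    rcases hp.eq_or_lt with h0 | h0
    · have : q = 1 := by linarith
      subst this
      rw [← h0]
      linarith
    · have := mul_pos h0 ht
      have := mul_nonneg hq hs.le
      linarith
  constructor
  · rintro ⟨t, u, e⟩ ⟨h1, h2, h3⟩ ⟨s, v, f⟩ ⟨k1, k2, k3⟩ p q hp hq hpq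
    simp only at h1 h2 h3 k1 k2 k3
    refine ⟨hpos p q t s hp hq hpq h1 k1, ?_, ?_⟩ <;>
    · simp only [Prod.smul_mk, Prod.mk_add_mk, smul_eq_mul]
      positivity
  · rintro ⟨t, u, e⟩ ⟨h1, h2, h3⟩ ⟨s, v, f⟩ ⟨k1, k2, k3⟩ p q hp hq hpq
    simp only at h1 h2 h3 k1 k2 k3
    simp only [Prod.smul_mk, Prod.mk_add_mk, smul_eq_mul]
    have hT := hpos p q t s hp hq hpq h1 k1
    have hM : p * min (a * e) (b * u) + q * min (a * f) (b * v)
        ≤ min (a * (p * e + q * f)) (b * (p * u + q * v)) := by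
      apply le_min
      · have i := mul_le_mul_of_nonneg_left (min_le_left (a * e) (b * u)) hp
        have j := mul_le_mul_of_nonneg_left (min_le_left (a * f) (b * v)) hq
        linarith
      · have i := mul_le_mul_of_nonneg_left (min_le_right (a * e) (b * u)) hp
        have j := mul_le_mul_of_nonneg_left (min_le_right (a * f) (b * v)) hq
        linarith
    have hm : 0 ≤ min (a * e) (b * u) := by positivity
    have hn : 0 ≤ min (a * f) (b * v) := by positivity
    generalize min (a * e) (b * u) = m at *
    generalize min (a * f) (b * v) = n at *
    generalize min (a * (p * e + q * f)) (b * (p * u + q * v)) = M at *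
    generalize hTd : p * t + q * s = T at *
    have hA : 0 < 1 + x / t * m := by positivity
    have hB : 0 < 1 + x / s * n := by positivity
    have key := strictConcaveOn_log_Ioi.concaveOn.2 (Set.mem_Ioi.2 hA) (Set.mem_Ioi.2 hB)
      (show 0 ≤ p * t / T by positivity) (show 0 ≤ q * s / T by positivity)
      (by rw [← add_div, hTd, div_self hT.ne'])
    simp only [smul_eq_mul] at key
    have heq : p * t / T * (1 + x / t * m) + q * s / T * (1 + x / s * n)
        = 1 + x / T * (p * m + q * n) := by
      field_simp
      rw [← hTd]
      ring
    rw [heq] at key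
    have hl : Real.log (1 + x / T * (p * m + q * n)) ≤ Real.log (1 + x / T * M) := by
      apply Real.log_le_log
      · positivity
      · gcongr
    have := mul_le_mul_of_nonneg_left (key.trans hl) hT.le
    refine le_trans (le_of_eq ?_) this
    field_simp
end

section
/- Let c_1 > 0, c_2 > 0, A ≥ 0, B ≥ 0 and λ > 0 be reals. Let z_0 ≥ 1 be the unique root of z·log z = z − 1 + B and let z_1 ≥ 1 be the unique root of z·log z = z − 1 + B + c_1. Assume (A + c_2)/λ > z_0 and A/λ < z_1. Then there exists exactly one pair (ρ, C) with 0 < ρ < 1 and C ≥ 1 satisfying the two equations C·log C − C + 1 = ρ·c_1 + B and λ·C = A + (1 − ρ)·c_2; moreover this solution satisfies C > 1. -/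
lemma g_strict {x y : ℝ} (hx : 1 ≤ x) (hxy : x < y) :
    x * Real.log x - x + 1 < y * Real.log y - y + 1 := by
  have hx0 : 0 < x := by linarith
  have hy0 : 0 < y := by linarith
  have h1 : Real.log (x / y) < x / y - 1 :=
    Real.log_lt_sub_one_of_pos (by positivity) ((div_lt_one hy0).2 hxy).ne
  rw [Real.log_div hx0.ne' hy0.ne'] at h1
  have h2 := mul_lt_mul_of_pos_left h1 hy0
  have h3 : y * (x / y - 1) = x - y := by field_simp
  have h4 : 0 ≤ (y - x) * Real.log x := mul_nonneg (by linarith) (Real.log_nonneg hx)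
  nlinarith

theorem rho_C_system_exists_unique
    (c1 c2 A B lam z0 z1 : ℝ)
    (hc1 : 0 < c1) (hc2 : 0 < c2) (hA : 0 ≤ A) (hB : 0 ≤ B) (hlam : 0 < lam)
    (hz0ge : 1 ≤ z0) (hz0 : z0 * Real.log z0 = z0 - 1 + B)
    (hz1ge : 1 ≤ z1) (hz1 : z1 * Real.log z1 = z1 - 1 + (B + c1))
    (hlow : (A + c2) / lam > z0) (hhigh : A / lam < z1) :
    (∃! rc : ℝ × ℝ,
      0 < rc.1 ∧ rc.1 < 1 ∧ 1 ≤ rc.2 ∧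
      rc.2 * Real.log rc.2 - rc.2 + 1 = rc.1 * c1 + B ∧
      lam * rc.2 = A + (1 - rc.1) * c2) ∧
    ∀ rc : ℝ × ℝ,
      0 < rc.1 → rc.1 < 1 → 1 ≤ rc.2 →
      rc.2 * Real.log rc.2 - rc.2 + 1 = rc.1 * c1 + B →
      lam * rc.2 = A + (1 - rc.1) * c2 → 1 < rc.2 := by
  constructor
  · have hz : z0 ≤ z1 := by
      by_contra! h
      have := g_strict hz1ge h
      linarith
    have hl : z0 * lam < A + c2 := (lt_div_iff₀ hlam).1 hlow
    have hh : A < z1 * lam := (div_lt_iff₀ hlam).1 hhigh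
    have hcont : ContinuousOn
        (fun C : ℝ => c1 * (lam * C - A - c2) + c2 * (C * Real.log C - C + 1 - B))
        (Set.Icc z0 z1) := by
      have := Real.continuous_mul_log
      fun_prop
    have h0 : c1 * (lam * z0 - A - c2) + c2 * (z0 * Real.log z0 - z0 + 1 - B) < 0 := by
      rw [hz0]; nlinarith
    have h1 : 0 < c1 * (lam * z1 - A - c2) + c2 * (z1 * Real.log z1 - z1 + 1 - B) := by
      rw [hz1]; nlinarith
    obtain ⟨C, ⟨hC0, hC1⟩, hC⟩ := intermediate_value_Ioo hz hcont ⟨h0, h1⟩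
    simp only at hC
    have hg0 := g_strict hz0ge hC0
    have hg1 := g_strict (by linarith) hC1
    refine ⟨((C * Real.log C - C + 1 - B) / c1, C), ⟨?_, ?_, ?_, ?_, ?_⟩, ?_⟩
    · exact div_pos (by linarith) hc1
    · exact (div_lt_one hc1).2 (by linarith)
    · show 1 ≤ C
      linarith
    · show _ = _ / c1 * c1 + B
      rw [div_mul_cancel₀ _ hc1.ne']; ring
    · show lam * C = A + (1 - _ / c1) * c2
      field_simp
      linarith
    · rintro ⟨r, D⟩ ⟨_, _, hD, e1, e2⟩
      simp only at hD e1 e2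
      have hDC : D = C := by
        have e3 : c1 * (lam * D - A - c2) + c2 * (D * Real.log D - D + 1 - B) = 0 := by
          rw [e1, e2]; ring
        rcases lt_trichotomy D C with h | h | h
        · have := g_strict hD h
          have a := mul_lt_mul_of_pos_left this hc2
          have b := mul_lt_mul_of_pos_left (mul_lt_mul_of_pos_left h hlam) hc1
          linarith
        · exact h
        · have := g_strict (by linarith) h
          have a := mul_lt_mul_of_pos_left this hc2
          have b := mul_lt_mul_of_pos_left (mul_lt_mul_of_pos_left h hlam) hc1
          linarith
      subst hDC
      ext
      · show r = _ / c1
        rw [e1]; field_simp; ring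
      · rfl
  · rintro ⟨r, D⟩ hr _ hD e1 _
    simp only at hr hD e1 ⊢
    rcases hD.lt_or_eq with h | h
    · exact h
    · subst h
      have := mul_pos hr hc1
      simp at e1
      linarith
end
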